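/- The only solution in positive integers (x,y,z) of the simultaneous system of Pell equations 2y² − x² = 1 and 3z² − x² = 2 is (x,y,z) = (1,1,1). -/

import Mathlib

open Pell in
theorem aux_double (a1 : 1 < 2) (n : ℕ) :
    (xn a1 (2 * n) : ℤ) = 2 * (xn a1 n : ℤ) ^ 2 - 1 := by
  have h := xn_add a1 n n
  have hp := pell_eqz a1 n
  have h' : (xn a1 (n + n) : ℤ) = xn a1 n * xn a1 n + (Pell.az 2 * Pell.az 2 - 1) * yn a1 n * yn a1 n := by
    have hz := dz_val a1
    rw [← hz]
    exact_mod_cast h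
  have hz := dz_val a1
  rw [hz] at hp
  simp only [xz, yz] at hp
  rw [two_mul, h']
  linarith

open Pell in
theorem aux_pow (a1 : 1 < 2) (s : ℕ) :
    xn a1 (2 ^ (s + 2)) % 40 = 17 := by
  induction s with
  | zero =>
    have h0 := xn_succ_succ a1 0
    have h1 := xn_succ_succ a1 1
    have h2 := xn_succ_succ a1 2
    simp only [xn_zero, xn_one, Nat.reduceAdd] at h0 h1 h2
    simp only [zero_add, Nat.reducePow]
    omega
  | succ s ih =>
    have h := aux_double a1 (2 ^ (s + 2))
    rw [show 2 ^ (s + 1 + 2) = 2 * 2 ^ (s + 2) by ring]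
    generalize xn a1 (2 ^ (s + 2)) = v at *
    generalize xn a1 (2 * 2 ^ (s + 2)) = w at *
    obtain ⟨k, rfl⟩ : ∃ k, v = 40 * k + 17 := ⟨v / 40, by omega⟩
    have : (w : ℤ) = 40 * (80 * (k:ℤ) ^ 2 + 68 * k + 14) + 17 := by
      rw [h]; push_cast; ring
    omega

theorem aux_jacobi (v : ℕ) (hv : v % 40 = 17) (a : ℤ) (h : (v : ℤ) ∣ (2 * a) ^ 2 + 10) :
    False := by
  have hodd : Odd v := by rw [Nat.odd_iff]; omega
  have h1 : jacobiSym (-10) v = -1 := by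
    rw [jacobiSym.mod_right _ hodd]
    have : v % (4 * (-10 : ℤ).natAbs) = 17 := by simpa using hv
    rw [this]
    norm_num
  have h2 : jacobiSym (-10) v = jacobiSym ((2 * a) ^ 2) v := by
    apply jacobiSym.mod_left'
    apply Int.ModEq.eq
    rw [Int.modEq_iff_dvd]
    simpa using h
  rw [jacobiSym.pow_left] at h2
  nlinarith [sq_nonneg (jacobiSym (2 * a) v)]

open Pell in
theorem aux_mod8 (a1 : 1 < 2) (n : ℕ) :
    xn a1 (4 * n) % 8 = 1 ∧ xn a1 (4 * n + 1) % 8 = 2 := by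
  induction n with
  | zero => simp
  | succ n ih =>
    have h0 := xn_succ_succ a1 (4 * n)
    have h1 := xn_succ_succ a1 (4 * n + 1)
    have h2 := xn_succ_succ a1 (4 * n + 2)
    have h3 := xn_succ_succ a1 (4 * n + 3)
    simp only [add_assoc, Nat.reduceAdd] at h0 h1 h2 h3
    rw [show 4 * (n + 1) = 4 * n + 4 by ring]
    simp only [add_assoc, Nat.reduceAdd]
    omega

open Pell in
theorem aux_shift (a1 : 1 < 2) (k j h : ℕ) :
    xn a1 (4 * k * h + j) ≡ xn a1 j [MOD xn a1 k] := by
  induction h with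
  | zero => simp; rfl
  | succ h ih =>
    rw [show 4 * k * (h + 1) + j = 4 * k + (4 * k * h + j) by ring]
    exact (xn_modEq_x4n_add a1 k _).trans ih

open Pell in
theorem aux_main (a1 : 1 < 2) (n : ℕ) (a : ℤ) (ha : Odd a)
    (h : (xn a1 n : ℤ) = 4 * a ^ 2 + 3) : n = 2 := by
  have hx2 : xn a1 2 = 7 := by
    have h0 := xn_succ_succ a1 0
    simp only [xn_zero, xn_one, Nat.reduceAdd] at h0
    omega
  -- n is 2 mod 4
  have hn4 : n % 4 = 2 := by
    obtain ⟨b, rfl⟩ := ha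
    have h7 : xn a1 n % 8 = 7 := by
      have : (xn a1 n : ℤ) = 8 * (2 * b ^ 2 + 2 * b) + 7 := by rw [h]; ring
      omega
    have h8 := aux_mod8 a1 (n / 4)
    have h0 := xn_succ_succ a1 (4 * (n / 4))
    have h1 := xn_succ_succ a1 (4 * (n / 4) + 1)
    simp only [add_assoc, Nat.reduceAdd] at h0 h1
    have h3 : n % 4 = 0 ∨ n % 4 = 1 ∨ n % 4 = 2 ∨ n % 4 = 3 := by omega
    have hd := Nat.div_add_mod n 4
    rcases h3 with h3 | h3 | h3 | h3
    · rw [h3, add_zero] at hd; rw [hd] at h8; omega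
    · rw [h3] at hd; rw [hd] at h8; omega
    · exact h3
    · rw [h3] at hd; rw [hd] at h1; omega
  by_contra hne
  -- write n = 4 k h + (2 k ± 2)
  have key : ∀ N : ℕ, N ≠ 0 → N % 8 = 0 →
      ∃ s h : ℕ, N = 2 * 2 ^ (s + 2) * (2 * h + 1) := by
    intro N hN hN8
    obtain ⟨M, rfl⟩ : ∃ M, N = 8 * M := ⟨N / 8, by omega⟩
    obtain ⟨s, m, hm, hM⟩ := Nat.exists_eq_two_pow_mul_odd (n := M) (by omega)
    obtain ⟨h, rfl⟩ := hm
    exact ⟨s, h, by rw [hM]; ring⟩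
  have fin : ∀ s : ℕ, xn a1 n + 7 ≡ 0 [MOD xn a1 (2 ^ (s + 2))] → False := by
    intro s hs
    apply aux_jacobi _ (aux_pow a1 s) a
    have := (Nat.modEq_zero_iff_dvd.1 hs)
    have h3 : ((xn a1 (2 ^ (s + 2)) : ℕ) : ℤ) ∣ ((xn a1 n + 7 : ℕ) : ℤ) := by exact_mod_cast this
    push_cast at h3
    rw [h] at h3
    convert h3 using 1
    ring
  have hcase : n % 8 = 2 ∨ n % 8 = 6 := by omega
  rcases hcase with hc | hc
  · obtain ⟨s, g, hg⟩ := key (n - 2) (by omega) (by omega)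
    apply fin s
    have hn : n = 4 * 2 ^ (s + 2) * g + (2 * 2 ^ (s + 2) + 2) := by
      have : n = 2 * 2 ^ (s + 2) * (2 * g + 1) + 2 := by omega
      rw [this]; ring
    have e1 := aux_shift a1 (2 ^ (s + 2)) (2 * 2 ^ (s + 2) + 2) g
    rw [← hn] at e1
    have e2 := xn_modEq_x2n_add a1 (2 ^ (s + 2)) 2
    rw [hx2] at e2
    exact (e1.add_right 7).trans e2
  · obtain ⟨s, g, hg⟩ := key (n + 2) (by omega) (by omega)
    apply fin s
    have hpos : 1 ≤ 2 ^ (s + 2) := Nat.one_le_two_pow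
    have hn : n = 4 * 2 ^ (s + 2) * g + (2 * 2 ^ (s + 2) - 2) := by
      have h5 : 2 * 2 ^ (s + 2) * (2 * g + 1) = 4 * 2 ^ (s + 2) * g + 2 * 2 ^ (s + 2) := by ring
      omega
    have e1 := aux_shift a1 (2 ^ (s + 2)) (2 * 2 ^ (s + 2) - 2) g
    rw [← hn] at e1
    have e2 := xn_modEq_x2n_sub a1 (n := 2 ^ (s + 2)) (j := 2) (by omega)
    rw [hx2] at e2
    exact (e1.add_right 7).trans e2

/-- `v² - 3u² = 1` and `v = 4a²+3` with `a` odd forces `v = 7`. -/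
theorem aux_ma (v u a : ℤ) (ha : Odd a) (hv : v = 4 * a ^ 2 + 3) (hp : v ^ 2 - 3 * u ^ 2 = 1) :
    a ^ 2 = 1 := by
  have a1 : 1 < 2 := by norm_num
  have hv0 : 0 ≤ v := by rw [hv]; positivity
  have hx2 : Pell.xn a1 2 = 7 := by
    have h0 := Pell.xn_succ_succ a1 0
    simp only [Pell.xn_zero, Pell.xn_one, Nat.reduceAdd] at h0
    omega
  have hN : v.natAbs * v.natAbs - 3 * u.natAbs * u.natAbs = 1 := by
    have : (v.natAbs * v.natAbs : ℕ) = 3 * u.natAbs * u.natAbs + 1 := by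
      zify
      have h1 := abs_mul_abs_self v
      have h2 := abs_mul_abs_self u
      nlinarith
    omega
  obtain ⟨n, hn, -⟩ := Pell.eq_pell a1 hN
  have hvn : v = (Pell.xn a1 n : ℤ) := by rw [← hn]; omega
  have := aux_main a1 n a ha (by rw [← hvn, hv])
  rw [this, hx2] at hvn
  push_cast at hvn
  linarith

theorem aux_sq (a b c : ℤ) (ha : 0 ≤ a) (h : IsCoprime a b) (he : a * b = c ^ 2) :
    ∃ t, a = t ^ 2 := by
  obtain ⟨t, ht | ht⟩ := Int.sq_of_gcd_eq_one (Int.isCoprime_iff_gcd_eq_one.1 h) he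
  · exact ⟨t, ht⟩
  · exact ⟨0, by nlinarith [sq_nonneg t]⟩

/-- `t⁴ - 2q² = 1` forces `q = 0`. -/
theorem aux_quartic_one (t q : ℤ) (h : (t ^ 2) ^ 2 - 2 * q ^ 2 = 1) : q = 0 := by
  have hodd : Odd t := by
    by_contra hc
    rw [Int.not_odd_iff_even] at hc
    obtain ⟨k, rfl⟩ := hc
    have : 2 * (8 * k ^ 4 - q ^ 2) = 1 := by linarith [h]
    omega
  obtain ⟨k, rfl⟩ := hodd
  have ht1 : 0 ≤ (2 * k + 1) ^ 2 - 1 := by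
    have : 0 ≤ k * (k + 1) := by
      rcases le_or_gt 0 k with hk | hk
      · positivity
      · nlinarith
    nlinarith
  obtain ⟨s, hs⟩ := aux_sq ((2 * k + 1) ^ 2 - 1) (2 * k ^ 2 + 2 * k + 1) q ht1
    ⟨-(k ^ 2 + k + 1), 2 * k ^ 2 + 2 * k + 1, by ring⟩ (by linarith)
  have hk : k * (k + 1) = 0 := by
    have h1 : (2 * k + 1 - s) * (2 * k + 1 + s) = 1 := by linarith
    rcases Int.mul_eq_one_iff_eq_one_or_neg_one.1 h1 with ⟨h2, h3⟩ | ⟨h2, h3⟩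
    · have : k = 0 := by omega
      rw [this]; ring
    · have : k = -1 := by omega
      rw [this]; ring
  have : q ^ 2 = 0 := by
    have : q ^ 2 = (4 * (k * (k + 1))) * (2 * k ^ 2 + 2 * k + 1) := by linarith
    rw [this, hk]; ring
  exact pow_eq_zero_iff (by norm_num) |>.1 this

/-- `9t⁴ - 2q² = 1` forces `t² = 1`. -/
theorem aux_quartic_three (t q : ℤ) (h : (3 * t ^ 2) ^ 2 - 2 * q ^ 2 = 1) : t ^ 2 = 1 := by
  have hodd : Odd t := by
    by_contra hc
    rw [Int.not_odd_iff_even] at hc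
    obtain ⟨k, rfl⟩ := hc
    have : 2 * (72 * k ^ 4 - q ^ 2) = 1 := by linarith [h]
    omega
  obtain ⟨k, hk⟩ := hodd
  -- A = (3t²-1)/2, C = (3t²+1)/4
  obtain ⟨C, hC⟩ : ∃ C, 3 * t ^ 2 + 1 = 4 * C := ⟨3 * k ^ 2 + 3 * k + 1, by rw [hk]; ring⟩
  have hA : 3 * t ^ 2 - 1 = 2 * (2 * C - 1) := by linarith
  have hq : q ^ 2 = 4 * ((2 * C - 1) * C) := by
    have : (3 * t ^ 2 - 1) * (3 * t ^ 2 + 1) = 2 * q ^ 2 := by linarith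
    rw [hA, hC] at this
    linarith
  have hqe : Even q := by
    have : Even (q ^ 2) := ⟨2 * ((2 * C - 1) * C), by rw [hq]; ring⟩
    exact (Int.even_pow.1 this).1
  obtain ⟨r, rfl⟩ := hqe
  have hC1 : 1 ≤ C := by
    have := sq_nonneg t
    omega
  have hr : (2 * C - 1) * C = r ^ 2 := by linarith
  obtain ⟨a, ha⟩ := aux_sq (2 * C - 1) C r (by omega) ⟨-1, 2, by ring⟩ hr
  obtain ⟨b, hb⟩ := aux_sq C (2 * C - 1) r (by omega) ⟨2, -1, by ring⟩ (by linarith)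
  have haodd : Odd a := by
    have : Odd (a ^ 2) := ⟨C - 1, by rw [← ha]; ring⟩
    exact Int.odd_pow' (by norm_num) |>.1 this
  have hP : (8 * b ^ 2 - 1) ^ 2 - 3 * (4 * b * t) ^ 2 = 1 := by
    have : 3 * t ^ 2 = 4 * b ^ 2 - 1 := by rw [← hb]; linarith
    have e : 3 * (4 * b * t) ^ 2 = 16 * b ^ 2 * (3 * t ^ 2) := by ring
    rw [e, this]; ring
  have h1 := aux_ma (8 * b ^ 2 - 1) (4 * b * t) a haodd (by rw [← hb, ← ha]; ring) hP
  rw [h1] at ha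
  linarith

/-- The only solution in positive integers of the simultaneous Pell equations
`2y² − x² = 1` and `3z² − x² = 2` is `(x,y,z) = (1,1,1)`. -/
theorem pell_system_only_trivial_solution (x y z : ℤ)
    (hx : 0 < x) (hy : 0 < y) (hz : 0 < z)
    (h1 : 2 * y ^ 2 - x ^ 2 = 1) (h2 : 3 * z ^ 2 - x ^ 2 = 2) :
    x = 1 ∧ y = 1 ∧ z = 1 := by
  obtain ⟨p, hp⟩ : ∃ p, p = 2 * y - x := ⟨_, rfl⟩
  obtain ⟨q, hq⟩ : ∃ q, q = x - y := ⟨_, rfl⟩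
  have hp0 : 0 < p := by
    rw [hp]; nlinarith
  have hq0 : 0 ≤ q := by
    rw [hq]; nlinarith
  have hpell : p ^ 2 - 2 * q ^ 2 = 1 := by rw [hp, hq]; linarith
  have hprod : p * (3 * p + 4 * q) = 3 * z ^ 2 := by
    rw [hp, hq]; linarith
  have hpodd : p % 2 = 1 := by
    rcases Int.emod_two_eq_zero_or_one p with h | h
    · obtain ⟨m, rfl⟩ : ∃ m, p = 2 * m := ⟨p / 2, by omega⟩
      have : 2 * (2 * m ^ 2 - q ^ 2) = 1 := by linarith
      omega
    · exact h
  have hcop : IsCoprime p (3 * p + 4 * q) := by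
    have e1 : IsCoprime p q := ⟨p, -2 * q, by linarith⟩
    have e2 : IsCoprime p 2 := ⟨1, -(p / 2), by omega⟩
    have e4 : IsCoprime p 4 := by
      have := e2.mul_right e2
      norm_num at this
      exact this
    have e3 : IsCoprime p (4 * q) := e4.mul_right e1
    have := e3.add_mul_left_right 3
    rwa [show 4 * q + p * 3 = 3 * p + 4 * q by ring] at this
  have h3 : (3 : ℤ) ∣ p * (3 * p + 4 * q) := ⟨z ^ 2, hprod⟩
  rcases Int.prime_three.dvd_or_dvd h3 with ⟨m, hm⟩ | ⟨m, hm⟩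
  · exfalso
    have hc : IsCoprime m (3 * p + 4 * q) := by
      rw [hm] at hcop ⊢
      exact hcop.of_mul_left_right
    obtain ⟨t, ht⟩ := aux_sq m (3 * p + 4 * q) z (by omega) hc (by
      have : 3 * (m * (3 * p + 4 * q)) = 3 * z ^ 2 := by rw [← hprod, ← mul_assoc, ← hm]
      linarith)
    have ht1 : t ^ 2 = 1 := by
      apply aux_quartic_three t q
      rw [← ht, ← hm]; exact hpell
    have hp3 : p = 3 := by rw [hm, ht, ht1]; rfl
    rw [hp3] at hpell hprod
    have hq2 : q = 2 := by nlinarith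
    rw [hq2] at hprod
    have : z ^ 2 = 17 := by linarith
    have : z < 5 := by nlinarith
    interval_cases z <;> omega
  · have hc : IsCoprime p m := by
      rw [hm] at hcop
      exact hcop.of_mul_right_right
    obtain ⟨t, ht⟩ := aux_sq p m z hp0.le hc (by
      have : 3 * (p * m) = 3 * z ^ 2 := by rw [← hprod, hm]; ring
      linarith)
    have hq00 : q = 0 := aux_quartic_one t q (by rw [← ht]; exact hpell)
    have hxy : x = y := by omega
    subst hxy
    have hx1 : x = 1 := by nlinarith
    subst hx1
    have hz1 : z = 1 := by nlinarith
    exact ⟨rfl, rfl, hz1⟩
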